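/- Let ∑_{i=1}^k αᵢ sᵢ ≥ 1 with α ∈ ℝ^k, α ≥ 0, be a valid inequality for conv(P(R,f)) whose induced lattice-free set L_α is a triangle of type T^{2B} with f in the interior of L_α. Then the split rank of ∑_{i=1}^k αᵢ sᵢ ≥ 1 with respect to P(R,f)⁰ is finite. -/

import Mathlib

open Set Pointwise

abbrev Pt : Type := Fin 2 → ℝ

def IsIntPt (x : Pt) : Prop := ∀ j, ∃ z : ℤ, x j = (z : ℝ)

def IsRatPt (x : Pt) : Prop := ∀ j, ∃ q : ℚ, x j = (q : ℝ)

/-- The mixed-integer set `P(R,f)`. -/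
def mixedP (k : ℕ) (r : Fin k → Pt) (f : Pt) : Set (Pt × (Fin k → ℝ)) :=
  {p | IsIntPt p.1 ∧ (∀ i, 0 ≤ p.2 i) ∧ p.1 = f + ∑ i, p.2 i • r i}

/-- The linear relaxation `P(R,f)⁰`. -/
def relaxP (k : ℕ) (r : Fin k → Pt) (f : Pt) : Set (Pt × (Fin k → ℝ)) :=
  {p | (∀ i, 0 ≤ p.2 i) ∧ p.1 = f + ∑ i, p.2 i • r i}

/-- The convex cone generated by a set (all nonnegative combinations). -/
def coneGen (S : Set Pt) : Set Pt :=
  {x | ∃ (n : ℕ) (c : Fin n → ℝ) (v : Fin n → Pt),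
    (∀ j, 0 ≤ c j) ∧ (∀ j, v j ∈ S) ∧ x = ∑ j, c j • v j}

/-- The induced lattice-free set `L_α`. -/
def inducedSet (k : ℕ) (r : Fin k → Pt) (f : Pt) (α : Fin k → ℝ) : Set Pt :=
  convexHull ℝ ({f} ∪ {x | ∃ i, 0 < α i ∧ x = f + (α i)⁻¹ • r i}) +
    coneGen {x | ∃ i, α i = 0 ∧ x = r i}

def LatticeFree (S : Set Pt) : Prop := ∀ x ∈ interior S, ¬ IsIntPt x

/-- Validity of `∑ αᵢ sᵢ ≥ γ` for `conv(P(R,f))`. -/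
def ValidIneq (k : ℕ) (r : Fin k → Pt) (f : Pt) (α : Fin k → ℝ) (γ : ℝ) : Prop :=
  ∀ p ∈ mixedP k r f, γ ≤ ∑ i, α i * p.2 i

noncomputable def affDim {V : Type*} [AddCommGroup V] [Module ℝ V] (S : Set V) : ℕ :=
  Module.finrank ℝ (affineSpan ℝ S).direction

/-- Facet-defining inequality: valid and its face of the closed convex hull has
affine dimension exactly one less. -/
def IsFacet (k : ℕ) (r : Fin k → Pt) (f : Pt) (α : Fin k → ℝ) (γ : ℝ) : Prop :=
  ValidIneq k r f α γ ∧
  affDim {p ∈ closure (convexHull ℝ (mixedP k r f)) | ∑ i, α i * p.2 i = γ} + 1 =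
    affDim (convexHull ℝ (mixedP k r f))

def splitClosure (k : ℕ) (C : Set (Pt × (Fin k → ℝ))) : Set (Pt × (Fin k → ℝ)) :=
  ⋂ (π : Fin 2 → ℤ) (π₀ : ℤ),
    convexHull ℝ ((C ∩ {p | ∑ j, (π j : ℝ) * p.1 j ≤ (π₀ : ℝ)}) ∪
      (C ∩ {p | (π₀ : ℝ) + 1 ≤ ∑ j, (π j : ℝ) * p.1 j}))

def closures (k : ℕ) (r : Fin k → Pt) (f : Pt) : ℕ → Set (Pt × (Fin k → ℝ))
  | 0 => relaxP k r f
  | n + 1 => splitClosure k (closures k r f n)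

/-- The split rank of `∑ αᵢ sᵢ ≥ γ` w.r.t. `P(R,f)⁰`: least `j` such that the
inequality is valid on the `j`-th split closure, `⊤` if none exists. -/
noncomputable def splitRank (k : ℕ) (r : Fin k → Pt) (f : Pt) (α : Fin k → ℝ) (γ : ℝ) : ℕ∞ :=
  sInf {j : ℕ∞ | ∃ n : ℕ, j = (n : ℕ∞) ∧ ∀ p ∈ closures k r f n, γ ≤ ∑ i, α i * p.2 i}

def IsSplitSet (S : Set Pt) : Prop :=
  ∃ (π : Fin 2 → ℤ) (π₀ : ℤ), π ≠ 0 ∧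
    S = {x : Pt | (π₀ : ℝ) ≤ ∑ j, (π j : ℝ) * x j ∧ ∑ j, (π j : ℝ) * x j ≤ (π₀ : ℝ) + 1}

/-- Triangle of type `T¹`. -/
def IsT1 (S : Set Pt) : Prop :=
  ∃ v : Fin 3 → Pt, AffineIndependent ℝ v ∧ (∀ i, IsIntPt (v i)) ∧
    S = convexHull ℝ (Set.range v) ∧
    ∀ i j, i ≠ j → ∃! z, z ∈ openSegment ℝ (v i) (v j) ∧ IsIntPt z

/-- Triangle of type `T^{2A}`. -/
def IsT2A (S : Set Pt) : Prop :=
  ∃ v0 v1 v2 : Pt, AffineIndependent ℝ ![v0, v1, v2] ∧ ¬ IsIntPt v0 ∧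
    S = convexHull ℝ {v0, v1, v2} ∧
    (∃ z1 z2 : Pt, z1 ≠ z2 ∧ IsIntPt z1 ∧ IsIntPt z2 ∧
      z1 ∈ segment ℝ v1 v2 ∧ z2 ∈ segment ℝ v1 v2) ∧
    (∃! z, z ∈ openSegment ℝ v0 v1 ∧ IsIntPt z) ∧
    (∃! z, z ∈ openSegment ℝ v0 v2 ∧ IsIntPt z)

/-- Triangle of type `T^{2B}`. -/
def IsT2B (S : Set Pt) : Prop :=
  ∃ v0 v1 v2 : Pt, AffineIndependent ℝ ![v0, v1, v2] ∧ ¬ IsIntPt v0 ∧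
    S = convexHull ℝ {v0, v1, v2} ∧
    (∃ z1 z2 : Pt, z1 ≠ z2 ∧ IsIntPt z1 ∧ IsIntPt z2 ∧
      z1 ∈ segment ℝ v1 v2 ∧ z2 ∈ segment ℝ v1 v2) ∧
    (∃! z, z ∈ openSegment ℝ v0 v1 ∧ IsIntPt z) ∧
    (∀ z ∈ openSegment ℝ v0 v2, ¬ IsIntPt z)

/-- Triangle of type `T³`. -/
def IsT3 (S : Set Pt) : Prop :=
  ∃ v0 v1 v2 : Pt, AffineIndependent ℝ ![v0, v1, v2] ∧
    ¬ IsIntPt v0 ∧ ¬ IsIntPt v1 ∧ ¬ IsIntPt v2 ∧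
    S = convexHull ℝ {v0, v1, v2} ∧
    (∃! z, z ∈ openSegment ℝ v0 v1 ∧ IsIntPt z) ∧
    (∃! z, z ∈ openSegment ℝ v1 v2 ∧ IsIntPt z) ∧
    (∃! z, z ∈ openSegment ℝ v0 v2 ∧ IsIntPt z) ∧
    (∀ z, IsIntPt z → z ∈ frontier S →
      z ∈ openSegment ℝ v0 v1 ∨ z ∈ openSegment ℝ v1 v2 ∨ z ∈ openSegment ℝ v0 v2)

/-- A quadrilateral with vertices `v 0, v 1, v 2, v 3` in cyclic order; each `vᵢ`
is an extreme point of the hull and each side lies on the boundary. -/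
def IsQuadWith (S : Set Pt) (v : Fin 4 → Pt) : Prop :=
  S = convexHull ℝ (Set.range v) ∧
  (∀ i, v i ∈ Set.extremePoints ℝ S) ∧
  (∀ i : Fin 4, segment ℝ (v i) (v (i + 1)) ⊆ frontier S)

/-- Quadrilateral of type `Q¹`. -/
def IsQ1 (S : Set Pt) : Prop :=
  ∃ v : Fin 4 → Pt, IsQuadWith S v ∧
    (∃ z1 z2 : Pt, z1 ≠ z2 ∧ IsIntPt z1 ∧ IsIntPt z2 ∧
      z1 ∈ segment ℝ (v 0) (v 1) ∧ z2 ∈ segment ℝ (v 0) (v 1)) ∧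
    (∃ j : Fin 4, j ≠ 0 ∧
      (∀ i : Fin 4, i ≠ 0 → i ≠ j → ∃ z, IsIntPt z ∧ z ∈ segment ℝ (v i) (v (i + 1))) ∧
      (∀ z ∈ openSegment ℝ (v j) (v (j + 1)), ¬ IsIntPt z)) ∧
    (∃ T : Set Pt, (IsT1 T ∨ IsT2A T) ∧ S ⊆ T)

/-- Quadrilateral of type `Q²`. -/
def IsQ2 (S : Set Pt) : Prop :=
  ∃ v : Fin 4 → Pt, IsQuadWith S v ∧ (∀ i, ¬ IsIntPt (v i)) ∧
    ∀ i : Fin 4, ∃! z, z ∈ openSegment ℝ (v i) (v (i + 1)) ∧ IsIntPt z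

/-! ### Split closures and affine cuts -/

/-- The affine form `x ↦ π · x - c` with integer coefficients. -/
noncomputable def latticeForm (π : Fin 2 → ℤ) (c : ℤ) : Pt →ᵃ[ℝ] ℝ :=
  (∑ j, (π j : ℝ) • (LinearMap.proj j : Pt →ₗ[ℝ] ℝ)).toAffineMap - AffineMap.const ℝ Pt (c : ℝ)

theorem latticeForm_apply (π : Fin 2 → ℤ) (c : ℤ) (x : Pt) :
    latticeForm π c x = ∑ j, (π j : ℝ) * x j - c := by
  simp [latticeForm]

theorem latticeForm_apply_two (π : Fin 2 → ℤ) (c : ℤ) (x : Pt) :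
    latticeForm π c x = π 0 * x 0 + π 1 * x 1 - c := by
  simp [latticeForm_apply]

theorem splitClosure_subset_of_convex {k : ℕ} {C H : Set (Pt × (Fin k → ℝ))} (hH : Convex ℝ H)
    (π : Fin 2 → ℤ) (c : ℤ) (h0 : ∀ p ∈ C, latticeForm π c p.1 ≤ 0 → p ∈ H)
    (h1 : ∀ p ∈ C, 1 ≤ latticeForm π c p.1 → p ∈ H) : splitClosure k C ⊆ H := by
  intro p hp
  simp only [splitClosure, mem_iInter] at hp
  refine convexHull_min ?_ hH (hp π c)
  rintro q (⟨hq, hq'⟩ | ⟨hq, hq'⟩)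
  · refine h0 q hq ?_
    rw [latticeForm_apply]
    exact sub_nonpos.2 hq'
  · refine h1 q hq ?_
    rw [latticeForm_apply]
    exact le_sub_iff_add_le'.2 hq'

theorem convex_cut {k : ℕ} (α : Fin k → ℝ) (g : Pt →ᵃ[ℝ] ℝ) :
    Convex ℝ {p : Pt × (Fin k → ℝ) | g p.1 ≤ ∑ i, α i * p.2 i} := by
  intro p hp q hq s t hs ht hst
  simp only [mem_ofPred_eq] at hp hq ⊢
  have hg : g (s • p + t • q).1 = s * g p.1 + t * g q.1 := by
    simpa using Convex.combo_affine_apply (f := g) (x := p.1) (y := q.1) hst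
  have hT : ∑ i, α i * (s • p + t • q).2 i
      = s * ∑ i, α i * p.2 i + t * ∑ i, α i * q.2 i := by
    rw [Finset.mul_sum, Finset.mul_sum, ← Finset.sum_add_distrib]
    refine Finset.sum_congr rfl fun i _ => ?_
    simp
    ring
  rw [hg, hT]
  gcongr

theorem cut_closures_succ {k : ℕ} {r : Fin k → Pt} {f : Pt} (α : Fin k → ℝ) (n : ℕ)
    (g : Pt →ᵃ[ℝ] ℝ) (π : Fin 2 → ℤ) (c : ℤ)
    (h0 : ∀ p ∈ closures k r f n, latticeForm π c p.1 ≤ 0 → g p.1 ≤ ∑ i, α i * p.2 i)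
    (h1 : ∀ p ∈ closures k r f n, 1 ≤ latticeForm π c p.1 → g p.1 ≤ ∑ i, α i * p.2 i) :
    ∀ p ∈ closures k r f (n + 1), g p.1 ≤ ∑ i, α i * p.2 i :=
  splitClosure_subset_of_convex (convex_cut α g) π c h0 h1

theorem convex_relaxP (k : ℕ) (r : Fin k → Pt) (f : Pt) : Convex ℝ (relaxP k r f) := by
  rintro p ⟨hp, hp'⟩ q ⟨hq, hq'⟩ s t hs ht hst
  refine ⟨fun i => ?_, ?_⟩
  · have := mul_nonneg hs (hp i)
    have := mul_nonneg ht (hq i)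
    simp
    linarith
  · simp only [Prod.fst_add, Prod.smul_fst, hp', hq', Prod.snd_add, Prod.smul_snd, Pi.add_apply,
      Pi.smul_apply, smul_eq_mul, add_smul, Finset.sum_add_distrib, mul_smul, ← Finset.smul_sum,
      smul_add]
    nth_rewrite 3 [← one_smul ℝ f]
    rw [← hst, add_smul]
    abel

theorem convex_closures (k : ℕ) (r : Fin k → Pt) (f : Pt) :
    ∀ n, Convex ℝ (closures k r f n)
  | 0 => convex_relaxP k r f
  | _ + 1 => convex_iInter fun _ => convex_iInter fun _ => convex_convexHull ℝ _

theorem antitone_closures (k : ℕ) (r : Fin k → Pt) (f : Pt) : Antitone (closures k r f) :=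
  antitone_nat_of_succ_le fun n =>
    splitClosure_subset_of_convex (convex_closures k r f n) 0 0 (fun _ hp _ => hp)
      (fun _ hp _ => hp)

section Core

variable {k : ℕ} {r : Fin k → Pt} {f : Pt} {α : Fin k → ℝ} {πX πY : Fin 2 → ℤ} {cX cY : ℤ}
  {a β l c e : ℝ}

/-- One application of the `Y`-split followed by one of the `X`-split shrinks the depth of the
relaxation below the level `1` by a fixed factor. -/
theorem closures_depth_contraction (hβ : 0 < β) (hl : 0 < l) (ha : 0 < a)
    (hbase : ∀ p ∈ relaxP k r f, 1 - β * latticeForm πY cY p.1 ≤ ∑ i, α i * p.2 i)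
    (hleft : ∀ p ∈ relaxP k r f,
      1 - l * (latticeForm πX cX p.1 - a * (latticeForm πY cY p.1 - 1)) ≤ ∑ i, α i * p.2 i)
    (hright : ∀ p ∈ relaxP k r f, 1 ≤ latticeForm πX cX p.1 →
      1 + e + c * (latticeForm πY cY p.1 - 1) ≤ ∑ i, α i * p.2 i)
    {μ₀ μ η : ℝ} (hμ₀ : 0 < μ₀) (hμ : μ₀ ≤ μ) (hη : 0 < η) (hη1 : η < 1) (hc : 0 < c)
    (hηl : l * a * η ≤ μ₀ * (1 - η)) (hηr : c * η ≤ e) {n : ℕ}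
    (hn : ∀ p ∈ closures k r f n, 1 - μ ≤ ∑ i, α i * p.2 i) :
    ∀ p ∈ closures k r f (n + 2), 1 - μ * (1 - η) ≤ ∑ i, α i * p.2 i := by
  have hsub (m : ℕ) : closures k r f m ⊆ relaxP k r f := antitone_closures k r f (Nat.zero_le m)
  have hν0 : 0 < min β μ := lt_min hβ (hμ₀.trans_le hμ)
  have hνβ := min_le_left β μ
  have hνμ := min_le_right β μ
  set ν := min β μ with hν
  have hY : ∀ p ∈ closures k r f (n + 1),
      1 - ν * latticeForm πY cY p.1 ≤ ∑ i, α i * p.2 i := by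
    have := cut_closures_succ (r := r) (f := f) α n
      (AffineMap.const ℝ Pt 1 - ν • latticeForm πY cY) πY cY ?_ ?_
    · simpa using this
    · intro p hp hp0
      have := hbase p (hsub n hp)
      simp
      nlinarith
    · intro p hp hp0
      simp
      rcases min_choice β μ with h | h
      · have := hbase p (hsub n hp)
        rw [hν, h]
        exact_mod_cast tsub_le_iff_right.1 this
      · have := hn p hp
        rw [hν, h]
        nlinarith
  have := cut_closures_succ (r := r) (f := f) α (n + 1)
    (AffineMap.const ℝ Pt (1 - μ * (1 - η))) πX cX ?_ ?_
  · simpa using this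
  · intro p hp hp0
    simp only [AffineMap.const_apply]
    by_contra! h
    have h1 := hY p hp
    have h2 := hleft p (hsub _ hp)
    have h3 : 1 - η < latticeForm πY cY p.1 := by
      by_contra! h'
      nlinarith
    nlinarith [mul_pos hl ha]
  · intro p hp hp0
    simp only [AffineMap.const_apply]
    by_contra! h
    have h1 := hY p hp
    have h2 := hright p (hsub _ hp) hp0
    have h3 : 1 - η < latticeForm πY cY p.1 := by
      by_contra! h'
      nlinarith
    nlinarith

theorem exists_closures_depth_le (hα : ∀ i, 0 ≤ α i) (hβ : 0 < β) (hl : 0 < l) (ha : 0 < a)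
    (hc : 0 < c) (he : 0 < e)
    (hbase : ∀ p ∈ relaxP k r f, 1 - β * latticeForm πY cY p.1 ≤ ∑ i, α i * p.2 i)
    (hleft : ∀ p ∈ relaxP k r f,
      1 - l * (latticeForm πX cX p.1 - a * (latticeForm πY cY p.1 - 1)) ≤ ∑ i, α i * p.2 i)
    (hright : ∀ p ∈ relaxP k r f, 1 ≤ latticeForm πX cX p.1 →
      1 + e + c * (latticeForm πY cY p.1 - 1) ≤ ∑ i, α i * p.2 i)
    {μ₀ : ℝ} (hμ₀ : 0 < μ₀) :
    ∃ n, ∀ p ∈ closures k r f n, 1 - μ₀ ≤ ∑ i, α i * p.2 i := by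
  obtain ⟨η, hη, hη1, hηl, hηr⟩ : ∃ η : ℝ, 0 < η ∧ η < 1 ∧ l * a * η ≤ μ₀ * (1 - η) ∧
      c * η ≤ e := by
    have hla := mul_pos hl ha
    refine ⟨min (μ₀ / (l * a + 2 * μ₀)) (e / c), lt_min (by positivity) (by positivity), ?_, ?_, ?_⟩
    · refine (min_le_left _ _).trans_lt ?_
      rw [div_lt_one (by positivity)]
      linarith
    · have h := min_le_left (μ₀ / (l * a + 2 * μ₀)) (e / c)
      rw [le_div_iff₀ (by positivity)] at h
      have : 0 < min (μ₀ / (l * a + 2 * μ₀)) (e / c) := lt_min (by positivity) (by positivity)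
      nlinarith
    · have h := min_le_right (μ₀ / (l * a + 2 * μ₀)) (e / c)
      rwa [le_div_iff₀' hc] at h
  have key (m : ℕ) : ∃ n, ∀ p ∈ closures k r f n,
      1 - max μ₀ ((1 - η) ^ m) ≤ ∑ i, α i * p.2 i := by
    induction m with
    | zero =>
      refine ⟨0, fun p hp => ?_⟩
      have h0 : 0 ≤ ∑ i, α i * p.2 i := Finset.sum_nonneg fun i _ => mul_nonneg (hα i) (hp.1 i)
      have := le_max_right μ₀ ((1 - η) ^ 0)
      rw [pow_zero] at this ⊢
      linarith
    | succ m ih =>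
      obtain ⟨n, hn⟩ := ih
      refine ⟨n + 2, fun p hp => ?_⟩
      have := closures_depth_contraction hβ hl ha hbase hleft hright hμ₀ (le_max_left _ _) hη hη1
        hc hηl hηr hn p hp
      refine le_trans (sub_le_sub_left ?_ 1) this
      have h1 : (0 : ℝ) ≤ 1 - η := by linarith
      rw [max_mul_of_nonneg _ _ h1, pow_succ]
      exact max_le_max_right _ (by nlinarith)
  obtain ⟨m, hm⟩ := exists_pow_lt_of_lt_one hμ₀ (by linarith : 1 - η < 1)
  obtain ⟨n, hn⟩ := key m
  refine ⟨n, fun p hp => ?_⟩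
  simpa [max_eq_left hm.le] using hn p hp

/-- If the relaxation satisfies the base, left and right inequalities below, where the left
inequality is parallel to a rational line through `(X, Y) = (0, 1)`, then the inequality
`∑ αᵢ sᵢ ≥ 1` has finite split rank. -/
theorem exists_closures_ge_one (hα : ∀ i, 0 ≤ α i) (hβ : 0 < β) (hl : 0 < l) (ha : 0 < a)
    (hc : 0 < c) (he : 0 < e)
    (hbase : ∀ p ∈ relaxP k r f, 1 - β * latticeForm πY cY p.1 ≤ ∑ i, α i * p.2 i)
    (hleft : ∀ p ∈ relaxP k r f,
      1 - l * (latticeForm πX cX p.1 - a * (latticeForm πY cY p.1 - 1)) ≤ ∑ i, α i * p.2 i)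
    (hright : ∀ p ∈ relaxP k r f, 1 ≤ latticeForm πX cX p.1 →
      1 + e + c * (latticeForm πY cY p.1 - 1) ≤ ∑ i, α i * p.2 i)
    {πD : Fin 2 → ℤ} {cD : ℤ} {M : ℝ} (hM : 0 < M)
    (hD : ∀ x, latticeForm πD cD x = M * (latticeForm πX cX x - a * (latticeForm πY cY x - 1))) :
    ∃ n, ∀ p ∈ closures k r f n, 1 ≤ ∑ i, α i * p.2 i := by
  have hsub (m : ℕ) : closures k r f m ⊆ relaxP k r f := antitone_closures k r f (Nat.zero_le m)
  obtain ⟨l', hl'0, hl'l, hl'c⟩ : ∃ l' : ℝ, 0 < l' ∧ l' ≤ l ∧ l' * a ≤ c :=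
    ⟨min l (c / a), lt_min hl (by positivity), min_le_left _ _,
      (le_div_iff₀ ha).1 (min_le_right _ _)⟩
  obtain ⟨n₁, hn₁⟩ := exists_closures_depth_le hα hβ hl ha hc he hbase hleft hright
    (div_pos hl'0 hM)
  have hflat : ∀ p ∈ closures k r f (n₁ + 1),
      1 - l' * (latticeForm πX cX p.1 - a * (latticeForm πY cY p.1 - 1)) ≤ ∑ i, α i * p.2 i := by
    have hD' (x : Pt) : l' * (latticeForm πX cX x - a * (latticeForm πY cY x - 1))
        = l' / M * latticeForm πD cD x := by
      rw [hD]
      field_simp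
    simp only [hD']
    have := cut_closures_succ (r := r) (f := f) α n₁
      (AffineMap.const ℝ Pt 1 - (l' / M) • latticeForm πD cD) πD cD ?_ ?_
    · simpa using this
    · intro p hp hp0
      have h := hleft p (hsub _ hp)
      have h2 : latticeForm πX cX p.1 - a * (latticeForm πY cY p.1 - 1) ≤ 0 := by
        rw [hD] at hp0
        exact nonpos_of_mul_nonpos_right hp0 hM
      have h3 := hD' p.1
      simp
      nlinarith
    · intro p hp hp0
      have h := hn₁ p hp
      have := div_pos hl'0 hM
      simp
      nlinarith
  have hσ : 0 < l' * a := mul_pos hl'0 ha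
  obtain ⟨n₂, hn₂⟩ := exists_closures_depth_le hα hβ hl ha hc he hbase hleft hright
    (μ₀ := l' * a * (e / c)) (by positivity)
  set n := max (n₁ + 1) n₂
  have htop : ∀ p ∈ closures k r f (n + 1),
      1 + l' * a * (latticeForm πY cY p.1 - 1) ≤ ∑ i, α i * p.2 i := by
    have := cut_closures_succ (r := r) (f := f) α n
      (AffineMap.const ℝ Pt 1 + (l' * a) • (latticeForm πY cY - AffineMap.const ℝ Pt 1)) πX cX ?_ ?_
    · simpa using this
    · intro p hp hp0
      have h := hflat p (antitone_closures k r f (le_max_left _ _) hp)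
      simp
      nlinarith
    · intro p hp hp0
      have h1 := hn₂ p (antitone_closures k r f (le_max_right _ _) hp)
      have h2 := hright p (hsub _ hp) hp0
      simp
      rcases le_total 1 (latticeForm πY cY p.1) with hy | hy
      · nlinarith
      · rcases le_total (c * (1 - latticeForm πY cY p.1)) e with hy' | hy'
        · nlinarith
        · have h3 : e / c ≤ 1 - latticeForm πY cY p.1 := by
            rwa [div_le_iff₀' hc]
          nlinarith
  refine ⟨n + 2, ?_⟩
  have := cut_closures_succ (r := r) (f := f) α (n + 1) (AffineMap.const ℝ Pt 1) πY cY ?_ ?_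
  · simpa using this
  · intro p hp hp0
    have h := hbase p (hsub _ hp)
    simp
    nlinarith
  · intro p hp hp0
    have h := htop p hp
    simp
    nlinarith

end Core

/-! ### Arithmetic of the triangle -/

theorem exists_right_bound {a a₂ w l ρ : ℝ} (ha : 0 < a) (hw0 : 0 ≤ w) (hw : w < 1)
    (hq : 0 < (1 - w) * a + a₂) (hl : 0 < l) (hρ : 0 < ρ) :
    ∃ c e : ℝ, 0 < c ∧ 0 < e ∧ ∀ X Y T : ℝ, 1 - l * (X - a * (Y - 1)) ≤ T →
      1 - ρ * (w - a₂ * (Y - 1) - X) ≤ T → 1 ≤ X → 1 + e + c * (Y - 1) ≤ T := by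
  obtain ⟨d, hd, hdw, hda⟩ : ∃ d : ℝ, 0 < d ∧ d ≤ 1 - w ∧ d * a < (1 - w) * a + a₂ := by
    refine ⟨min (1 - w) (((1 - w) * a + a₂) / (2 * a)), lt_min (by linarith) (by positivity),
      min_le_left _ _, ?_⟩
    have h := min_le_right (1 - w) (((1 - w) * a + a₂) / (2 * a))
    rw [le_div_iff₀ (by positivity)] at h
    linarith
  have ht : 0 ≤ (1 - w - d) / l := div_nonneg (by linarith) hl.le
  have hS : 0 < (1 - w - d) / l + 1 / ρ := by positivity
  refine ⟨((1 - w) * a + a₂ - d * a) / ((1 - w - d) / l + 1 / ρ),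
    d / ((1 - w - d) / l + 1 / ρ), div_pos (by linarith) hS, by positivity, ?_⟩
  intro X Y T h1 h2 hX
  have h3 : -((1 - w - d) * (X - a * (Y - 1))) ≤ (1 - w - d) / l * (T - 1) := by
    have := mul_le_mul_of_nonneg_left (show -(l * (X - a * (Y - 1))) ≤ T - 1 by linarith) ht
    refine le_trans (le_of_eq ?_) this
    field_simp
  have h4 : -(w - a₂ * (Y - 1) - X) ≤ 1 / ρ * (T - 1) := by
    have := mul_le_mul_of_nonneg_left (show -(ρ * (w - a₂ * (Y - 1) - X)) ≤ T - 1 by linarith)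
      (show 0 ≤ 1 / ρ by positivity)
    refine le_trans (le_of_eq ?_) this
    field_simp
  have h5 : d + ((1 - w) * a + a₂ - d * a) * (Y - 1) ≤ (T - 1) * ((1 - w - d) / l + 1 / ρ) := by
    nlinarith [mul_nonneg (add_nonneg hw0 hd.le) (sub_nonneg.2 hX)]
  have h6 := (div_le_iff₀ hS).2 h5
  rw [add_div, mul_div_right_comm] at h6
  linarith

/-- The integer point on the left side of the triangle with vertices `(x₁, 0)`, `(x₂, 0)` and
`(x₀, h)` is at height one. -/
theorem height_eq_one {x₀ x₁ x₂ h : ℝ} {n₁ n₂ zi zj : ℤ}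
    (hfree : ∀ i j : ℤ, (0 : ℝ) < j → 0 < (i - x₁) * h - (x₀ - x₁) * j →
      ¬ 0 < (x₂ - i) * h + (x₀ - x₂) * j)
    (hleft : ∀ i j : ℤ, (0 : ℝ) < j → (j : ℝ) < h → (i - x₁) * h - (x₀ - x₁) * j = 0 → j = zj)
    (hn : n₁ < n₂) (hn₁ : x₁ ≤ n₁) (hn₂ : (n₂ : ℝ) ≤ x₂)
    (hz0 : (0 : ℝ) < zj) (hzh : (zj : ℝ) < h) (hz : (zi - x₁) * h - (x₀ - x₁) * zj = 0) :
    zj = 1 := by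
  by_contra hne
  have hz0' : 0 < zj := by exact_mod_cast hz0
  have hh : 0 < h := hz0.trans hzh
  obtain ⟨x, hx1, hx2⟩ : ∃ x : ℤ, zi - n₁ + n₁ * zj ≤ x * zj ∧
      x * zj ≤ zi - n₁ + n₁ * zj + (zj - 1) := by
    refine ⟨n₁ + (zi - n₁ + zj - 1) / zj, ?_, ?_⟩
    · have := Int.lt_ediv_add_one_mul_self (zi - n₁ + zj - 1) hz0'
      linarith
    · have := Int.ediv_mul_le (zi - n₁ + zj - 1) hz0'.ne'
      linarith
  have hzj1 : (1 : ℝ) ≤ zj := by exact_mod_cast hz0'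
  have hn' : (n₁ : ℝ) + 1 ≤ n₂ := by exact_mod_cast hn
  have hx1' : (zi : ℝ) - n₁ + n₁ * zj ≤ x * zj := by exact_mod_cast hx1
  have hx2' : (x : ℝ) * zj ≤ zi - n₁ + n₁ * zj + (zj - 1) := by exact_mod_cast hx2
  have hl : 0 ≤ ((x - x₁) * h - (x₀ - x₁) * (1 : ℤ)) * zj := by
    have : 0 ≤ (x * zj - zi - (zj - 1) * x₁) * h := mul_nonneg (by nlinarith) hh.le
    push_cast
    linarith
  have hr : 0 < ((x₂ - x) * h + (x₀ - x₂) * (1 : ℤ)) * zj := by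
    have h1 : 0 ≤ ((zj - 1) * x₂ - (x * zj - zi)) * h := mul_nonneg (by nlinarith) hh.le
    have h2 : 0 < (x₂ - x₁) * (h - zj) := mul_pos (by linarith) (by linarith)
    push_cast
    linarith
  have hl' := nonneg_of_mul_nonneg_left hl hz0
  have hr' := (mul_pos_iff_of_pos_right hz0).1 hr
  rcases hl'.eq_or_lt with h0 | h0
  · refine hne (hleft x 1 (by norm_num) ?_ h0.symm).symm
    push_cast
    linarith
  · exact hfree x 1 (by norm_num) h0 hr'

/-- A shear that puts the left base vertex at `-a` with `a > 0`, the apex strictly to the left of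
the line `X = 1`, and the right side strictly to the left of the point `(1, 1)`. -/
theorem exists_shear {x₀ x₁ x₂ h : ℝ} {n₁ n₂ zi : ℤ}
    (hfree : ∀ i j : ℤ, (0 : ℝ) < j → 0 < (i - x₁) * h - (x₀ - x₁) * j →
      ¬ 0 < (x₂ - i) * h + (x₀ - x₂) * j)
    (hleft : ∀ i j : ℤ, (0 : ℝ) < j → (j : ℝ) < h → (i - x₁) * h - (x₀ - x₁) * j = 0 → j = 1)
    (hright : ∀ i j : ℤ, (0 : ℝ) < j → (j : ℝ) < h → (x₂ - i) * h + (x₀ - x₂) * j ≠ 0)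
    (hapex : ∀ i j : ℤ, x₀ = i → h ≠ j)
    (hn : n₁ < n₂) (hn₁ : x₁ ≤ n₁) (hn₂ : (n₂ : ℝ) ≤ x₂)
    (hh : 1 < h) (hz : (zi - x₁) * h = x₀ - x₁) :
    ∃ n : ℤ, 0 < n + zi - x₁ ∧ (n + zi - x₁) * (h - 1) < 1 ∧ (x₂ - x₁) * (h - 1) < h := by
  have hw : (x₂ - x₁) * (h - 1) < h := by
    by_contra! hcon
    have hr : (x₂ - (zi + 1 : ℤ)) * h + (x₀ - x₂) * (1 : ℤ) = (x₂ - x₁) * (h - 1) - h := by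
      push_cast
      linear_combination -hz
    have hl : 0 < ((zi + 1 : ℤ) - x₁) * h - (x₀ - x₁) * (1 : ℤ) := by
      push_cast
      linarith
    have h1 := hfree (zi + 1) 1 (by norm_num) hl
    exact hright (zi + 1) 1 (by norm_num) (by simpa using hh)
      (le_antisymm (not_lt.1 h1) (by rw [hr]; linarith))
  refine ⟨⌊x₁ - zi⌋ + 1, ?_, ?_, hw⟩
  · have := Int.lt_floor_add_one (x₁ - zi)
    push_cast
    linarith
  set n : ℤ := ⌊x₁ - zi⌋ + 1 with hn_def
  have ha1 : n + zi - x₁ ≤ 1 := by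
    have := Int.floor_le (x₁ - zi)
    rw [hn_def]
    push_cast
    linarith
  have ha0 : 0 < n + zi - x₁ := by
    have := Int.lt_floor_add_one (x₁ - zi)
    rw [hn_def]
    push_cast
    linarith
  rcases ha1.eq_or_lt with ha | ha
  · rw [ha, one_mul]
    by_contra! hcon
    have hl : ((1 - n + zi : ℤ) - x₁) * h - (x₀ - x₁) * (2 : ℤ) = 0 := by
      push_cast
      linear_combination (-h) * ha + 2 * hz
    rcases (show 2 ≤ h by linarith).eq_or_lt with h2 | h2
    · refine hapex (zi - n + 1) 2 ?_ (by exact_mod_cast h2.symm)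
      push_cast
      rw [← h2] at hz
      linarith
    · have := hleft (1 - n + zi) 2 (by norm_num) (by exact_mod_cast h2) hl
      norm_num at this
  · have h1 : n + zi ≤ n₁ := by
      have : ((n + zi : ℤ) : ℝ) < (n₁ + 1 : ℤ) := by
        push_cast
        linarith
      exact Int.lt_add_one_iff.1 (by exact_mod_cast this)
    have h2 : n + zi + 1 ≤ n₂ := by omega
    have h3 : (n : ℝ) + zi + 1 ≤ n₂ := by exact_mod_cast h2
    nlinarith

/-! ### The induced set -/

section InducedSet

variable {k : ℕ} {r : Fin k → Pt} {f : Pt} {α : Fin k → ℝ}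

theorem ray_mem_inducedSet {i : Fin k} (hi : 0 < α i) :
    f + (α i)⁻¹ • r i ∈ inducedSet k r f α :=
  ⟨_, subset_convexHull ℝ _ (Or.inr ⟨i, hi, rfl⟩), 0, ⟨0, Fin.elim0, Fin.elim0, by simp⟩, by simp⟩

theorem recession_mem_inducedSet {i : Fin k} (hi : α i = 0) {t : ℝ} (ht : 0 ≤ t) :
    f + t • r i ∈ inducedSet k r f α :=
  ⟨_, subset_convexHull ℝ _ (Or.inl rfl), t • r i,
    ⟨1, fun _ => t, fun _ => r i, fun _ => ht, fun _ => ⟨i, hi, rfl⟩, by simp⟩, rfl⟩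

/-- An affine function that is nonnegative on the induced set and positive at `f` gives a valid
inequality for the linear relaxation. -/
theorem cut_of_nonneg_inducedSet (hα : ∀ i, 0 ≤ α i) (g : Pt →ᵃ[ℝ] ℝ)
    (hg : ∀ x ∈ inducedSet k r f α, 0 ≤ g x) (hgf : 0 < g f) :
    ∀ p ∈ relaxP k r f, 1 - (g f)⁻¹ * g p.1 ≤ ∑ i, α i * p.2 i := by
  have hlin (x : Pt) : g (f + x) = g f + g.linear x := by
    rw [add_comm f x, ← vadd_eq_add, g.map_vadd, vadd_eq_add, add_comm]
  have hr (i : Fin k) : -(α i * g f) ≤ g.linear (r i) := by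
    rcases (hα i).eq_or_lt with h | h
    · rw [← h, zero_mul, neg_zero]
      by_contra! hneg
      have h1 := hg _ (recession_mem_inducedSet (r := r) (f := f) h.symm
        (t := 2 * g f / -g.linear (r i)) (div_nonneg (by linarith) (by linarith)))
      rw [hlin, map_smul, smul_eq_mul, div_mul_eq_mul_div, div_neg, mul_div_assoc,
        div_self hneg.ne] at h1
      linarith
    · have h1 := hg _ (ray_mem_inducedSet (r := r) (f := f) h)
      rw [hlin, map_smul, smul_eq_mul] at h1
      have h2 := mul_nonneg h.le h1
      rw [mul_add, mul_inv_cancel_left₀ h.ne'] at h2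
      linarith
  rintro p ⟨hp, hp'⟩
  have h1 : g f * (1 - ∑ i, α i * p.2 i) ≤ g p.1 := by
    rw [hp', hlin, map_sum, mul_sub, mul_one, sub_eq_add_neg, Finset.mul_sum,
      ← Finset.sum_neg_distrib]
    gcongr with i
    rw [map_smul, smul_eq_mul]
    nlinarith [mul_le_mul_of_nonneg_left (hr i) (hp i)]
  have h2 := mul_le_mul_of_nonneg_left h1 (inv_nonneg.2 hgf.le)
  rw [inv_mul_cancel_left₀ hgf.ne'] at h2
  linarith

theorem exists_repr_of_mem_inducedSet {x : Pt}
    (hx : x ∈ inducedSet k r f α) :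
    ∃ s : Fin k → ℝ, (∀ i, 0 ≤ s i) ∧ x = f + ∑ i, s i • r i ∧ ∑ i, α i * s i ≤ 1 := by
  obtain ⟨y, hy, z, ⟨n, c, v, hc, hv, rfl⟩, rfl⟩ := hx
  have hhull : convexHull ℝ ({f} ∪ {x | ∃ i, 0 < α i ∧ x = f + (α i)⁻¹ • r i}) ⊆
      {x | ∃ s : Fin k → ℝ, (∀ i, 0 ≤ s i) ∧ x = f + ∑ i, s i • r i ∧ ∑ i, α i * s i ≤ 1} := by
    refine convexHull_min ?_ ?_
    · rintro x (rfl | ⟨i, hi, rfl⟩)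
      · exact ⟨0, by simp, by simp, by simp⟩
      · refine ⟨Pi.single i (α i)⁻¹, fun j => ?_, ?_, ?_⟩
        · exact (Pi.single_nonneg.2 (inv_nonneg.2 hi.le) : (0 : Fin k → ℝ) ≤ Pi.single i (α i)⁻¹) j
        · simp [Pi.single_apply, ite_smul]
        · simp [Pi.single_apply, hi.ne']
    · rintro x ⟨s, hs, rfl, hs1⟩ y ⟨t, ht, rfl, ht1⟩ p q hp hq hpq
      refine ⟨p • s + q • t, fun i => ?_, ?_, ?_⟩
      · exact add_nonneg (mul_nonneg hp (hs i)) (mul_nonneg hq (ht i))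
      · simp only [smul_add, Pi.add_apply, Pi.smul_apply, smul_eq_mul, add_smul, mul_smul,
          Finset.sum_add_distrib, Finset.smul_sum]
        nth_rewrite 3 [← one_smul ℝ f]
        rw [← hpq, add_smul]
        abel
      · have : ∑ i, α i * (p • s + q • t) i = p * ∑ i, α i * s i + q * ∑ i, α i * t i := by
          rw [Finset.mul_sum, Finset.mul_sum, ← Finset.sum_add_distrib]
          refine Finset.sum_congr rfl fun i _ => ?_
          simp
          ring
        rw [this]
        nlinarith
  obtain ⟨s, hs, rfl, hs1⟩ := hhull hy
  choose w hw hw' using hv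
  refine ⟨s + ∑ j, Pi.single (w j) (c j), fun i => ?_, ?_, ?_⟩
  · refine add_nonneg (hs i) ?_
    rw [Finset.sum_apply]
    exact Finset.sum_nonneg fun j _ =>
      (Pi.single_nonneg.2 (hc j) : (0 : Fin k → ℝ) ≤ Pi.single (w j) (c j)) i
  · simp only [Pi.add_apply, add_smul, Finset.sum_add_distrib, Finset.sum_apply, Finset.sum_smul]
    rw [Finset.sum_comm (s := Finset.univ (α := Fin k))]
    simp only [Pi.single_apply, ite_smul, zero_smul, Finset.sum_ite_eq',
      Finset.mem_univ, if_true, hw']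
    abel
  · simp only [Pi.add_apply, mul_add, Finset.sum_add_distrib, Finset.sum_apply, Finset.mul_sum]
    rw [Finset.sum_comm (s := Finset.univ (α := Fin k))]
    simpa [Pi.single_apply, hw] using hs1

/-- Validity of `∑ αᵢ sᵢ ≥ 1` means that no integer point can be pushed away from `f` while
staying in the induced set. -/
theorem not_mem_inducedSet_of_valid (hvalid : ValidIneq k r f α 1) {x : Pt}
    (hx : IsIntPt x) {ε : ℝ} (hε : 0 < ε) : f + (1 + ε) • (x - f) ∉ inducedSet k r f α := by
  intro hmem
  obtain ⟨s, hs, hs', hs1⟩ := exists_repr_of_mem_inducedSet hmem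
  have h1 : (1 + ε) ≠ 0 := by positivity
  have hpt : x = f + ∑ i, ((1 + ε)⁻¹ • s) i • r i := by
    simp only [Pi.smul_apply, smul_eq_mul, mul_smul, ← Finset.smul_sum]
    rw [← add_left_cancel hs', inv_smul_smul₀ h1, add_sub_cancel]
  have h2 := hvalid (x, (1 + ε)⁻¹ • s) ⟨hx, fun i => mul_nonneg (by positivity) (hs i), hpt⟩
  have h3 : ∑ i, α i * ((1 + ε)⁻¹ • s) i = (1 + ε)⁻¹ * ∑ i, α i * s i := by
    rw [Finset.mul_sum]
    refine Finset.sum_congr rfl fun i _ => ?_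
    simp
    ring
  simp only [h3] at h2
  have h4 : (1 + ε)⁻¹ < 1 := inv_lt_one_of_one_lt₀ (by linarith)
  have h5 : (0 : ℝ) < (1 + ε)⁻¹ := by positivity
  nlinarith

/-- An affine function bounded by `1` on the induced set, attaining `1` there but not at `f`,
attains `1` at the end of a ray. -/
theorem exists_ray_eq_one (g : Pt →ᵃ[ℝ] ℝ) (hg : ∀ x ∈ inducedSet k r f α, g x ≤ 1)
    (hgf : g f < 1) {v : Pt} (hv : v ∈ inducedSet k r f α) (hgv : g v = 1) :
    ∃ i, 0 < α i ∧ g (f + (α i)⁻¹ • r i) = 1 := by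
  by_contra! hcon
  have hlin (y x : Pt) : g (y + x) = g y + g.linear x := by
    rw [add_comm y x, ← vadd_eq_add, g.map_vadd, vadd_eq_add, add_comm]
  have hrec (i : Fin k) (hi : α i = 0) : g.linear (r i) ≤ 0 := by
    by_contra! hpos
    have h1 := hg _ (recession_mem_inducedSet (r := r) (f := f) hi
      (t := 2 * (1 - g f) / g.linear (r i)) (div_nonneg (by linarith) hpos.le))
    rw [hlin, map_smul, smul_eq_mul, div_mul_cancel₀ _ hpos.ne'] at h1
    linarith
  obtain ⟨y, hy, z, ⟨n, c, w, hc, hw, rfl⟩, rfl⟩ := hv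
  have hy1 : g y < 1 := by
    have hconv : Convex ℝ {x | g x < 1} := (convex_Iio (1 : ℝ)).affine_preimage g
    refine convexHull_min (t := {x | g x < 1}) ?_ hconv hy
    rintro x (rfl | ⟨i, hi, rfl⟩)
    · exact hgf
    · exact lt_of_le_of_ne (hg _ (ray_mem_inducedSet hi)) (hcon i hi)
  have hz : g.linear (∑ j, c j • w j) ≤ 0 := by
    rw [map_sum]
    refine Finset.sum_nonpos fun j _ => ?_
    obtain ⟨i, hi, hwi⟩ := hw j
    rw [map_smul, smul_eq_mul, hwi]
    exact mul_nonpos_of_nonneg_of_nonpos (hc j) (hrec i hi)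
  simp only [hlin] at hgv
  linarith

end InducedSet

/-! ### Lattice coordinates -/

theorem exists_unimodular {z₁ z₂ : Pt} (h₁ : IsIntPt z₁) (h₂ : IsIntPt z₂) (hne : z₁ ≠ z₂) :
    ∃ (πX πY : Fin 2 → ℤ) (c : ℤ), πX 0 * πY 1 - πX 1 * πY 0 = 1 ∧
      latticeForm πY c z₁ = 0 ∧ latticeForm πY c z₂ = 0 := by
  choose a ha using h₁
  choose b hb using h₂
  have hg : Int.gcd (b 0 - a 0) (b 1 - a 1) ≠ 0 := by
    intro h0
    rw [Int.gcd_eq_zero_iff] at h0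
    refine hne (funext fun j => ?_)
    have : a j = b j := by
      fin_cases j
      · exact (sub_eq_zero.1 h0.1).symm
      · exact (sub_eq_zero.1 h0.2).symm
    rw [ha, hb, this]
  obtain ⟨u, v, huv, hu, hv⟩ := Int.exists_gcd_one (Nat.pos_of_ne_zero hg)
  set g : ℤ := ((Int.gcd (b 0 - a 0) (b 1 - a 1) : ℕ) : ℤ)
  have hbez := Int.gcd_eq_gcd_ab u v
  rw [huv] at hbez
  refine ⟨![Int.gcdA u v, Int.gcdB u v], ![-v, u], -v * a 0 + u * a 1, ?_, ?_, ?_⟩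
  · simp
    push_cast at hbez
    linarith
  · rw [latticeForm_apply_two, ha, ha]
    simp
  · rw [latticeForm_apply_two, hb, hb]
    have hu' : (b 0 : ℝ) = a 0 + u * g := by
      rw [← sub_eq_iff_eq_add']
      exact_mod_cast hu
    have hv' : (b 1 : ℝ) = a 1 + v * g := by
      rw [← sub_eq_iff_eq_add']
      exact_mod_cast hv
    simp [hu', hv']
    ring

theorem exists_int_latticeForm {x : Pt} (hx : IsIntPt x) (π : Fin 2 → ℤ) (c : ℤ) :
    ∃ i : ℤ, latticeForm π c x = i := by
  choose a ha using hx
  refine ⟨π 0 * a 0 + π 1 * a 1 - c, ?_⟩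
  rw [latticeForm_apply_two, ha, ha]
  push_cast
  ring

section Unimodular

variable {πX πY : Fin 2 → ℤ} (cX cY : ℤ)

theorem exists_isIntPt_latticeForm_eq
    (hdet : (πX 0 * πY 1 - πX 1 * πY 0) * (πX 0 * πY 1 - πX 1 * πY 0) = 1) (i j : ℤ) :
    ∃ x, IsIntPt x ∧ latticeForm πX cX x = i ∧ latticeForm πY cY x = j := by
  set d := πX 0 * πY 1 - πX 1 * πY 0 with hd
  refine ⟨![((d * (πY 1 * (i + cX) - πX 1 * (j + cY)) : ℤ) : ℝ),
    ((d * (πX 0 * (j + cY) - πY 0 * (i + cX)) : ℤ) : ℝ)], ?_, ?_, ?_⟩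
  · intro l
    fin_cases l
    · exact ⟨_, rfl⟩
    · exact ⟨_, rfl⟩
  · rw [latticeForm_apply_two]
    simp only [Matrix.cons_val_zero, Matrix.cons_val_one]
    have : πX 0 * (d * (πY 1 * (i + cX) - πX 1 * (j + cY)))
        + πX 1 * (d * (πX 0 * (j + cY) - πY 0 * (i + cX))) - cX = i := by
      linear_combination (i + cX) * hdet - d * (i + cX) * hd
    exact_mod_cast this
  · rw [latticeForm_apply_two]
    simp only [Matrix.cons_val_zero, Matrix.cons_val_one]
    have : πY 0 * (d * (πY 1 * (i + cX) - πX 1 * (j + cY)))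
        + πY 1 * (d * (πX 0 * (j + cY) - πY 0 * (i + cX))) - cY = j := by
      linear_combination (j + cY) * hdet - d * (j + cY) * hd
    exact_mod_cast this

variable {cX cY}

theorem eq_of_latticeForm_eq
    (hdet : (πX 0 * πY 1 - πX 1 * πY 0) * (πX 0 * πY 1 - πX 1 * πY 0) = 1) {x y : Pt}
    (hX : latticeForm πX cX x = latticeForm πX cX y)
    (hY : latticeForm πY cY x = latticeForm πY cY y) : x = y := by
  have hdet' : ((πX 0 : ℝ) * πY 1 - πX 1 * πY 0) * (πX 0 * πY 1 - πX 1 * πY 0) = 1 := by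
    exact_mod_cast hdet
  have hd : (πX 0 : ℝ) * πY 1 - πX 1 * πY 0 ≠ 0 := fun h => by simp [h] at hdet'
  simp only [latticeForm_apply_two] at hX hY
  funext l
  refine mul_left_cancel₀ hd ?_
  fin_cases l
  · change _ * x 0 = _ * y 0
    linear_combination (πY 1 : ℝ) * hX - (πX 1 : ℝ) * hY
  · change _ * x 1 = _ * y 1
    linear_combination (πX 0 : ℝ) * hY - (πY 0 : ℝ) * hX

end Unimodular

/-! ### Triangles in barycentric coordinates -/

theorem affineMap_eq_sum_coord (b : AffineBasis (Fin 3) ℝ Pt) (g : Pt →ᵃ[ℝ] ℝ) (x : Pt) :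
    g x = b.coord 0 x * g (b 0) + b.coord 1 x * g (b 1) + b.coord 2 x * g (b 2) := by
  conv_lhs => rw [← b.affineCombination_coord_eq_self x]
  rw [Finset.map_affineCombination _ _ _ (b.sum_coord_apply_eq_one x),
    Finset.affineCombination_eq_linear_combination _ _ _ (b.sum_coord_apply_eq_one x)]
  simp [Fin.sum_univ_three]

theorem coord_add_coord (b : AffineBasis (Fin 3) ℝ Pt) (x : Pt) :
    b.coord 0 x + b.coord 1 x + b.coord 2 x = 1 := by
  rw [← b.sum_coord_apply_eq_one x, Fin.sum_univ_three]

theorem latticeForm_smul (σ : ℤ) (π : Fin 2 → ℤ) (c : ℤ) (x : Pt) :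
    latticeForm (σ • π) (σ * c) x = σ * latticeForm π c x := by
  simp only [latticeForm_apply_two, Pi.smul_apply, smul_eq_mul, Int.cast_mul]
  ring

theorem exists_sign_mul_pos {t : ℝ} (ht : t ≠ 0) : ∃ σ : ℤ, σ * σ = 1 ∧ 0 < σ * t := by
  rcases ht.lt_or_gt with h | h
  · exact ⟨-1, by norm_num, by push_cast; linarith⟩
  · exact ⟨1, by norm_num, by push_cast; linarith⟩

theorem exists_lattice_coordinates (b : AffineBasis (Fin 3) ℝ Pt) {z₁ z₂ : Pt} (h₁ : IsIntPt z₁)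
    (h₂ : IsIntPt z₂) (hne : z₁ ≠ z₂) (hz₁ : b.coord 0 z₁ = 0) (hz₂ : b.coord 0 z₂ = 0) :
    ∃ (πX πY : Fin 2 → ℤ) (cY : ℤ),
      (πX 0 * πY 1 - πX 1 * πY 0) * (πX 0 * πY 1 - πX 1 * πY 0) = 1 ∧
      latticeForm πY cY (b 1) = 0 ∧ latticeForm πY cY (b 2) = 0 ∧ 0 < latticeForm πY cY (b 0) ∧
      latticeForm πX 0 (b 1) < latticeForm πX 0 (b 2) := by
  obtain ⟨πX, πY, c, hdet, hY₁, hY₂⟩ := exists_unimodular h₁ h₂ hne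
  have hdet2 : (πX 0 * πY 1 - πX 1 * πY 0) * (πX 0 * πY 1 - πX 1 * πY 0) = 1 := by
    rw [hdet, one_mul]
  have hs₁ := coord_add_coord b z₁
  have hs₂ := coord_add_coord b z₂
  have hcne : b.coord 1 z₁ - b.coord 1 z₂ ≠ 0 := by
    intro h
    refine hne ?_
    rw [← b.linear_combination_coord_eq_self z₁, ← b.linear_combination_coord_eq_self z₂]
    have h2 : b.coord 2 z₁ = b.coord 2 z₂ := by linarith
    rw [Fin.sum_univ_three, Fin.sum_univ_three, hz₁, hz₂, h2, sub_eq_zero.1 h]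
  have hE₁ := affineMap_eq_sum_coord b (latticeForm πY c) z₁
  have hE₂ := affineMap_eq_sum_coord b (latticeForm πY c) z₂
  rw [hY₁, hz₁] at hE₁
  rw [hY₂, hz₂] at hE₂
  have hYb₁ : latticeForm πY c (b 1) = 0 := by
    refine (mul_eq_zero.1 ?_).resolve_left hcne
    linear_combination (b.coord 2 z₁) * hE₂ - (b.coord 2 z₂) * hE₁
      + (b.coord 1 z₂ * latticeForm πY c (b 1)) * (hs₁ - hz₁)
      - (b.coord 1 z₁ * latticeForm πY c (b 1)) * (hs₂ - hz₂)
  have hYb₂ : latticeForm πY c (b 2) = 0 := by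
    refine (mul_eq_zero.1 ?_).resolve_left hcne
    rw [hYb₁] at hE₁ hE₂
    linear_combination latticeForm πY c (b 2) * (hs₁ - hz₁ - hs₂ + hz₂) + hE₁ - hE₂
  have hYb₀ : latticeForm πY c (b 0) ≠ 0 := by
    intro h
    obtain ⟨x, -, -, hx⟩ := exists_isIntPt_latticeForm_eq 0 c hdet2 0 1
    rw [affineMap_eq_sum_coord b, h, hYb₁, hYb₂] at hx
    norm_num at hx
  have hXb : latticeForm πX 0 (b 2) - latticeForm πX 0 (b 1) ≠ 0 := by
    intro h
    have := b.ind.injective (eq_of_latticeForm_eq hdet2 (sub_eq_zero.1 h) (hYb₂.trans hYb₁.symm))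
    exact absurd this (by decide)
  obtain ⟨σ, hσ, hσ'⟩ := exists_sign_mul_pos hXb
  obtain ⟨τ, hτ, hτ'⟩ := exists_sign_mul_pos hYb₀
  refine ⟨σ • πX, τ • πY, τ * c, ?_, ?_, ?_, ?_, ?_⟩
  · simp only [Pi.smul_apply, smul_eq_mul]
    linear_combination τ * τ * hσ + hτ + σ * σ * τ * τ * hdet2
  · rw [latticeForm_smul, hYb₁, mul_zero]
  · rw [latticeForm_smul, hYb₂, mul_zero]
  · rwa [latticeForm_smul]
  · have h0 : σ * 0 = 0 := mul_zero σ
    rw [← h0, latticeForm_smul, latticeForm_smul, ← sub_pos, ← mul_sub]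
    exact hσ'

theorem latticeForm_shear (πX πY : Fin 2 → ℤ) (cX cY n m : ℤ) (x : Pt) :
    latticeForm (πX + n • πY) (cX + n * cY + m) x
      = latticeForm πX cX x + n * latticeForm πY cY x - m := by
  simp only [latticeForm_apply_two, Pi.add_apply, Pi.smul_apply, smul_eq_mul, Int.cast_add,
    Int.cast_mul]
  ring

/-- A lattice-free triangle `b 0, b 1, b 2` with at least two lattice points on the side opposite
to `b 0`, exactly one in the interior of the side `b 0, b 1` and none in the interior of the side
`b 0, b 2` can be brought to a normal form by an affine unimodular transformation. -/
theorem exists_normal_form (b : AffineBasis (Fin 3) ℝ Pt)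
    (hfree : ∀ x, IsIntPt x → 0 < b.coord 0 x → 0 < b.coord 1 x → ¬ 0 < b.coord 2 x)
    (hapex : ¬ IsIntPt (b 0)) {z₁ z₂ z : Pt} (h₁ : IsIntPt z₁) (h₂ : IsIntPt z₂) (hne : z₁ ≠ z₂)
    (hz₁ : b.coord 0 z₁ = 0) (hz₂ : b.coord 0 z₂ = 0) (hz₁' : ∀ i, 0 ≤ b.coord i z₁)
    (hz₂' : ∀ i, 0 ≤ b.coord i z₂) (hz : IsIntPt z) (hz0 : 0 < b.coord 0 z)
    (hz1 : 0 < b.coord 1 z) (hz2 : b.coord 2 z = 0)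
    (hleft : ∀ x, IsIntPt x → 0 < b.coord 0 x → 0 < b.coord 1 x → b.coord 2 x = 0 → x = z)
    (hright : ∀ x, IsIntPt x → 0 < b.coord 0 x → 0 < b.coord 2 x → b.coord 1 x ≠ 0) :
    ∃ (πX πY : Fin 2 → ℤ) (cX cY : ℤ) (a d h : ℝ),
      0 < a ∧ 0 < d ∧ 1 < h ∧ d * (h - 1) < h ∧ a * (h - 1) < 1 ∧
      latticeForm πX cX (b 0) = a * (h - 1) ∧ latticeForm πX cX (b 1) = -a ∧
      latticeForm πX cX (b 2) = d - a ∧ latticeForm πY cY (b 0) = h ∧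
      latticeForm πY cY (b 1) = 0 ∧ latticeForm πY cY (b 2) = 0 := by
  obtain ⟨πX, πY, cY, hdet, hY1, hY2, hh, hX12⟩ :=
    exists_lattice_coordinates b h₁ h₂ hne hz₁ hz₂
  set h := latticeForm πY cY (b 0) with hh_def
  set x₀ := latticeForm πX 0 (b 0) with hx₀
  set x₁ := latticeForm πX 0 (b 1) with hx₁
  set x₂ := latticeForm πX 0 (b 2) with hx₂
  have hY (x : Pt) : latticeForm πY cY x = b.coord 0 x * h := by
    rw [affineMap_eq_sum_coord b, hY1, hY2, mul_zero, mul_zero, add_zero, add_zero]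
  have hX (x : Pt) : latticeForm πX 0 x = b.coord 0 x * x₀ + b.coord 1 x * x₁ + b.coord 2 x * x₂ :=
    affineMap_eq_sum_coord b _ x
  have hc2 (x : Pt) : (latticeForm πX 0 x - x₁) * h - (x₀ - x₁) * latticeForm πY cY x
      = b.coord 2 x * ((x₂ - x₁) * h) := by
    rw [hX, hY]
    linear_combination (x₁ * h) * coord_add_coord b x
  have hc1 (x : Pt) : (x₂ - latticeForm πX 0 x) * h + (x₀ - x₂) * latticeForm πY cY x
      = b.coord 1 x * ((x₂ - x₁) * h) := by
    rw [hX, hY]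
    linear_combination -(x₂ * h) * coord_add_coord b x
  have hd : 0 < (x₂ - x₁) * h := mul_pos (sub_pos.2 hX12) hh
  have hpt := exists_isIntPt_latticeForm_eq 0 cY hdet
  obtain ⟨zi, hzi⟩ := exists_int_latticeForm hz πX 0
  obtain ⟨zj, hzj⟩ := exists_int_latticeForm hz πY cY
  have hzj0 : (0 : ℝ) < zj := by
    rw [← hzj, hY]
    exact mul_pos hz0 hh
  have hzjh : (zj : ℝ) < h := by
    rw [← hzj, hY]
    have := coord_add_coord b z
    exact mul_lt_of_lt_one_left hh (by linarith)
  have hzl : ((zi : ℝ) - x₁) * h - (x₀ - x₁) * zj = 0 := by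
    rw [← hzi, ← hzj, hc2, hz2, zero_mul]
  have hfree' : ∀ i j : ℤ, (0 : ℝ) < j → 0 < (i - x₁) * h - (x₀ - x₁) * j →
      ¬ 0 < (x₂ - i) * h + (x₀ - x₂) * j := by
    intro i j hj hp hq
    obtain ⟨x, hx, hxi, hxj⟩ := hpt i j
    rw [← hxi, ← hxj, hc2] at hp
    rw [← hxi, ← hxj, hc1] at hq
    rw [← hxj, hY] at hj
    exact hfree x hx (pos_of_mul_pos_left hj hh.le) (pos_of_mul_pos_left hq hd.le)
      (pos_of_mul_pos_left hp hd.le)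
  have hleft' : ∀ i j : ℤ, (0 : ℝ) < j → (j : ℝ) < h →
      (i - x₁) * h - (x₀ - x₁) * j = 0 → j = zj := by
    intro i j hj hjh hp
    obtain ⟨x, hx, hxi, hxj⟩ := hpt i j
    rw [← hxi, ← hxj, hc2] at hp
    rw [← hxj, hY] at hj hjh
    have hx2 := (mul_eq_zero.1 hp).resolve_right hd.ne'
    have hx0 := lt_of_mul_lt_mul_right (hjh.trans_eq (one_mul h).symm) hh.le
    have hs := coord_add_coord b x
    have hxz := hleft x hx (pos_of_mul_pos_left hj hh.le) (by linarith) hx2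
    rw [hxz, hzj] at hxj
    exact_mod_cast hxj.symm
  have hright' : ∀ i j : ℤ, (0 : ℝ) < j → (j : ℝ) < h → (x₂ - i) * h + (x₀ - x₂) * j ≠ 0 := by
    intro i j hj hjh hp
    obtain ⟨x, hx, hxi, hxj⟩ := hpt i j
    rw [← hxi, ← hxj, hc1] at hp
    rw [← hxj, hY] at hj hjh
    have hx1 := (mul_eq_zero.1 hp).resolve_right hd.ne'
    have hx0 := lt_of_mul_lt_mul_right (hjh.trans_eq (one_mul h).symm) hh.le
    have hs := coord_add_coord b x
    exact hright x hx (pos_of_mul_pos_left hj hh.le) (by linarith) hx1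
  have hapex' : ∀ i j : ℤ, x₀ = i → h ≠ j := by
    intro i j hi hj
    obtain ⟨x, hx, hxi, hxj⟩ := hpt i j
    refine hapex ?_
    rwa [← eq_of_latticeForm_eq hdet (hxi.trans hi.symm) (hxj.trans hj.symm)]
  obtain ⟨m₁, hm₁⟩ := exists_int_latticeForm h₁ πX 0
  obtain ⟨m₂, hm₂⟩ := exists_int_latticeForm h₂ πX 0
  have hbase (x : Pt) (h0 : b.coord 0 x = 0) (hx : ∀ i, 0 ≤ b.coord i x) :
      x₁ ≤ latticeForm πX 0 x ∧ latticeForm πX 0 x ≤ x₂ := by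
    have hs := coord_add_coord b x
    have hs1 : b.coord 1 x = 1 - b.coord 2 x := by linarith
    rw [hX, h0, hs1]
    have := hx 1
    constructor <;> nlinarith [hx 1, hx 2]
  obtain ⟨n₁, n₂, hn, hn₁, hn₂⟩ : ∃ n₁ n₂ : ℤ, n₁ < n₂ ∧ x₁ ≤ n₁ ∧ n₂ ≤ x₂ := by
    have hb₁ := hm₁ ▸ hbase z₁ hz₁ hz₁'
    have hb₂ := hm₂ ▸ hbase z₂ hz₂ hz₂'
    have hmne : m₁ ≠ m₂ := by
      rintro rfl
      exact hne (eq_of_latticeForm_eq hdet (hm₁.trans hm₂.symm) (by rw [hY, hY, hz₁, hz₂]))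
    rcases hmne.lt_or_gt with hlt | hlt
    · exact ⟨m₁, m₂, hlt, hb₁.1, hb₂.2⟩
    · exact ⟨m₂, m₁, hlt, hb₂.1, hb₁.2⟩
  obtain rfl : zj = 1 := height_eq_one hfree' hleft' hn hn₁ hn₂ hzj0 hzjh hzl
  rw [Int.cast_one] at hzjh hzl
  obtain ⟨n, hn0, hn1, hn2⟩ := exists_shear hfree' hleft' hright' hapex' hn hn₁ hn₂ hzjh
    (zi := zi) (by linarith)
  refine ⟨πX + n • πY, πY, 0 + n * cY + (n + zi), cY, n + zi - x₁, x₂ - x₁, h, hn0,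
    sub_pos.2 hX12, hzjh, hn2, hn1, ?_, ?_, ?_, rfl, hY1, hY2⟩
  · rw [latticeForm_shear, ← hx₀, ← hh_def]
    push_cast
    linarith
  · rw [latticeForm_shear, ← hx₁, hY1]
    push_cast
    linarith
  · rw [latticeForm_shear, ← hx₂, hY2]
    push_cast
    linarith

theorem exists_rat_latticeForm {x : Pt} (hx : IsRatPt x) (π : Fin 2 → ℤ) (c : ℤ) :
    ∃ q : ℚ, latticeForm π c x = q := by
  choose a ha using hx
  refine ⟨π 0 * a 0 + π 1 * a 1 - c, ?_⟩
  rw [latticeForm_apply_two, ha, ha]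
  push_cast
  ring

theorem latticeForm_add_smul (π : Fin 2 → ℤ) (c : ℤ) (x y : Pt) (t : ℝ) :
    latticeForm π c (x + t • y) = latticeForm π c x + t * latticeForm π 0 y := by
  simp only [latticeForm_apply_two, Pi.add_apply, Pi.smul_apply, smul_eq_mul, Int.cast_zero]
  ring

/-- Where a rational ray meets a rational line, integral forms are rational. -/
theorem exists_rat_latticeForm_of_ray {x y : Pt} (hx : IsRatPt x) (hy : IsRatPt y)
    {πX πY : Fin 2 → ℤ} {cX cY : ℤ} {t : ℝ} (hxY : latticeForm πY cY x ≠ 0)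
    (h : latticeForm πY cY (x + t • y) = 0) : ∃ q : ℚ, latticeForm πX cX (x + t • y) = q := by
  obtain ⟨q₁, hq₁⟩ := exists_rat_latticeForm hx πX cX
  obtain ⟨q₂, hq₂⟩ := exists_rat_latticeForm hx πY cY
  obtain ⟨q₃, hq₃⟩ := exists_rat_latticeForm hy πX 0
  obtain ⟨q₄, hq₄⟩ := exists_rat_latticeForm hy πY 0
  rw [latticeForm_add_smul, hq₂, hq₄] at h
  have hq4 : (q₄ : ℝ) ≠ 0 := fun h0 => hxY (by rw [hq₂]; simpa [h0] using h)
  refine ⟨q₁ - q₂ / q₄ * q₃, ?_⟩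
  have ht : t = -(q₂ / q₄) := by
    field_simp
    linarith
  rw [latticeForm_add_smul, hq₁, hq₃, ht]
  push_cast
  ring

theorem eq_of_coord_eq_one (b : AffineBasis (Fin 3) ℝ Pt) {x : Pt} (hx : ∀ i, 0 ≤ b.coord i x)
    (h1 : b.coord 1 x = 1) : x = b 1 := by
  have hs := coord_add_coord b x
  have h0 : b.coord 0 x = 0 := by linarith [hx 0, hx 2]
  have h2 : b.coord 2 x = 0 := by linarith [hx 0, hx 2]
  rw [← b.linear_combination_coord_eq_self x, Fin.sum_univ_three, h0, h1, h2]
  simp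

section Final

variable {k : ℕ} {r : Fin k → Pt} {f : Pt} {α : Fin k → ℝ}

/-- A valid inequality has no lattice point in the interior of a triangular induced set. -/
theorem not_coord_pos_of_valid (b : AffineBasis (Fin 3) ℝ Pt)
    (hvalid : ValidIneq k r f α 1) (hL : ∀ x, x ∈ inducedSet k r f α ↔ ∀ i, 0 ≤ b.coord i x)
    {x : Pt} (hx : IsIntPt x) : ¬ ∀ i, 0 < b.coord i x := by
  intro hpos
  have hcont : Filter.Tendsto (fun ε : ℝ => f + (1 + ε) • (x - f)) (nhdsWithin 0 (Ioi 0))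
      (nhds x) := by
    have : Continuous fun ε : ℝ => f + (1 + ε) • (x - f) := by fun_prop
    simpa using (this.tendsto 0).mono_left nhdsWithin_le_nhds
  have hev : ∀ᶠ ε : ℝ in nhdsWithin 0 (Ioi 0), ∀ i, 0 < b.coord i (f + (1 + ε) • (x - f)) := by
    refine Filter.eventually_all.2 fun i => ?_
    have hc : Continuous (b.coord i) := (b.coord i).continuous_of_finiteDimensional
    exact (((hc.tendsto x).comp hcont).eventually (lt_mem_nhds (hpos i)))
  obtain ⟨ε, hε, hε0⟩ := (hev.and self_mem_nhdsWithin).exists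
  exact not_mem_inducedSet_of_valid hvalid hx hε0 ((hL _).2 fun i => (hε i).le)

theorem exists_closures_ge_one_of_normal_form (b : AffineBasis (Fin 3) ℝ Pt)
    (hr : ∀ i, IsRatPt (r i)) (hf : IsRatPt f) (hα : ∀ i, 0 ≤ α i)
    (hL : ∀ x, x ∈ inducedSet k r f α ↔ ∀ i, 0 ≤ b.coord i x) (hfpos : ∀ i, 0 < b.coord i f)
    {πX πY : Fin 2 → ℤ} {cX cY : ℤ} {a d h : ℝ} (ha : 0 < a) (hd : 0 < d) (hh : 1 < h)
    (hdh : d * (h - 1) < h) (hah : a * (h - 1) < 1)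
    (hX0 : latticeForm πX cX (b 0) = a * (h - 1)) (hX1 : latticeForm πX cX (b 1) = -a)
    (hX2 : latticeForm πX cX (b 2) = d - a) (hY0 : latticeForm πY cY (b 0) = h)
    (hY1 : latticeForm πY cY (b 1) = 0) (hY2 : latticeForm πY cY (b 2) = 0) :
    ∃ n, ∀ p ∈ closures k r f n, 1 ≤ ∑ i, α i * p.2 i := by
  have hh0 : 0 < h := by linarith
  have hcut (i : Fin 3) := cut_of_nonneg_inducedSet hα (b.coord i) (fun x hx => (hL x).1 hx i)
    (hfpos i)
  have hY (x : Pt) : latticeForm πY cY x = b.coord 0 x * h := by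
    rw [affineMap_eq_sum_coord b, hY0, hY1, hY2, mul_zero, mul_zero, add_zero, add_zero]
  have hX (x : Pt) : latticeForm πX cX x
      = b.coord 0 x * (a * (h - 1)) + b.coord 1 x * -a + b.coord 2 x * (d - a) := by
    rw [affineMap_eq_sum_coord b, hX0, hX1, hX2]
  set w := d * (h - 1) / h with hw
  have hwh : w * h = d * (h - 1) := div_mul_cancel₀ _ hh0.ne'
  have hw0 : 0 ≤ w := div_nonneg (mul_nonneg hd.le (by linarith)) hh0.le
  have hw1 : w < 1 := (div_lt_one hh0).2 hdh
  have hc0 (x : Pt) : b.coord 0 x = h⁻¹ * latticeForm πY cY x := by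
    rw [hY]
    field_simp
  have hc2 (x : Pt) : b.coord 2 x
      = d⁻¹ * (latticeForm πX cX x - a * (latticeForm πY cY x - 1)) := by
    rw [eq_inv_mul_iff_mul_eq₀ hd.ne', hX, hY]
    linear_combination a * coord_add_coord b x
  have hc1 (x : Pt) : b.coord 1 x
      = d⁻¹ * (w - (d - a - w) * (latticeForm πY cY x - 1) - latticeForm πX cX x) := by
    rw [eq_inv_mul_iff_mul_eq₀ hd.ne', hX, hY]
    linear_combination (d - a) * coord_add_coord b x - b.coord 0 x * hwh
  have hq : 0 < (1 - w) * a + (d - a - w) := by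
    have : 0 < ((1 - w) * a + (d - a - w)) * h := by
      have h1 : ((1 - w) * a + (d - a - w)) * h = d * (1 - a * (h - 1)) := by
        linear_combination -(1 + a) * hwh
      rw [h1]
      exact mul_pos hd (by linarith)
    exact pos_of_mul_pos_left this hh0.le
  obtain ⟨c, e, hc, he, hright⟩ := exists_right_bound (ρ := (b.coord 1 f)⁻¹ * d⁻¹) ha hw0 hw1 hq
    (mul_pos (inv_pos.2 (hfpos 2)) (inv_pos.2 hd)) (mul_pos (inv_pos.2 (hfpos 1)) (inv_pos.2 hd))
  obtain ⟨q, hqa⟩ : ∃ q : ℚ, a = q := by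
    have hle (x : Pt) (hx : x ∈ inducedSet k r f α) : b.coord 1 x ≤ 1 := by
      have := (hL x).1 hx
      linarith [coord_add_coord b x, this 0, this 2]
    have hlt : b.coord 1 f < 1 := by linarith [coord_add_coord b f, hfpos 0, hfpos 2]
    obtain ⟨i, hi, hi1⟩ := exists_ray_eq_one (b.coord 1) hle hlt
      ((hL (b 1)).2 fun j => by rw [b.coord_apply]; split_ifs <;> norm_num) (b.coord_apply_eq 1)
    have hb1 := eq_of_coord_eq_one b ((hL _).1 (ray_mem_inducedSet hi)) hi1
    have hYf : latticeForm πY cY f ≠ 0 := by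
      rw [hY]
      exact (mul_pos (hfpos 0) hh0).ne'
    obtain ⟨q, hq⟩ := exists_rat_latticeForm_of_ray (πX := πX) (cX := cX) hf (hr i) hYf
      (hb1 ▸ hY1)
    rw [hb1, hX1] at hq
    exact ⟨-q, by rw [Rat.cast_neg, ← hq, neg_neg]⟩
  have hM : (0 : ℝ) < (q.den : ℤ) := by exact_mod_cast q.den_pos
  have haM : ((q.den : ℤ) : ℝ) * a = q.num := by
    rw [hqa]
    exact_mod_cast Rat.den_mul_eq_num q
  refine exists_closures_ge_one (πX := πX) (πY := πY) (cX := cX) (cY := cY)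
    (πD := (q.den : ℤ) • πX + (-q.num) • πY) (cD := q.den * cX + -q.num * cY + -q.num)
    hα (mul_pos (inv_pos.2 (hfpos 0)) (inv_pos.2 hh0))
    (mul_pos (inv_pos.2 (hfpos 2)) (inv_pos.2 hd)) ha hc he ?_ ?_ ?_ hM ?_
  · intro p hp
    rw [mul_assoc, ← hc0]
    exact hcut 0 p hp
  · intro p hp
    rw [mul_assoc, ← hc2]
    exact hcut 2 p hp
  · intro p hp hpX
    refine hright _ _ _ ?_ ?_ hpX
    · rw [mul_assoc, ← hc2]
      exact hcut 2 p hp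
    · rw [mul_assoc, ← hc1]
      exact hcut 1 p hp
  · intro x
    rw [latticeForm_shear, latticeForm_smul]
    push_cast at haM ⊢
    linear_combination (latticeForm πY cY x - 1) * haM

end Final

theorem t2B_finite_split_rank (k : ℕ)
    (hk : 1 ≤ k)
    (r : Fin k → Pt) (f : Pt)
    (hr_rat : ∀ i, IsRatPt (r i)) (hr_ne : ∀ i, r i ≠ 0)
    (hf_rat : IsRatPt f) (hf_int : ¬ IsIntPt f)
    (hne : (mixedP k r f).Nonempty)
    (α : Fin k → ℝ) (hα : ∀ i, 0 ≤ α i)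
    (hvalid : ValidIneq k r f α 1)
    (hshape : IsT2B (inducedSet k r f α))
    (hfint : f ∈ interior (inducedSet k r f α)) :
    splitRank k r f α 1 ≠ ⊤ := by
  obtain ⟨v0, v1, v2, hind, hv0, hLv, ⟨z₁, z₂, hne, h₁, h₂, hs₁, hs₂⟩, ⟨z, ⟨hz, hzi⟩, huniq⟩,
    hopen⟩ := hshape
  let b : AffineBasis (Fin 3) ℝ Pt := ⟨![v0, v1, v2], hind,
    (hind.affineSpan_eq_top_iff_card_eq_finrank_add_one).2 (by simp)⟩
  have hrange : inducedSet k r f α = convexHull ℝ (range b) := by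
    rw [hLv]
    congr 1
    change _ = range ![v0, v1, v2]
    ext x
    simp [eq_comm]
    tauto
  have hL (x : Pt) : x ∈ inducedSet k r f α ↔ ∀ i, 0 ≤ b.coord i x := by
    rw [hrange, b.convexHull_eq_nonneg_coord, mem_ofPred_eq]
  have hfpos : ∀ i, 0 < b.coord i f := by
    rw [hrange, b.interior_convexHull] at hfint
    exact hfint
  have hcoord {i j : Fin 3} {x : Pt} {s t : ℝ} (hst : s + t = 1) (hx : s • b i + t • b j = x)
      (l : Fin 3) : b.coord l x = s * b.coord l (b i) + t * b.coord l (b j) := by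
    rw [← hx]
    simpa using Convex.combo_affine_apply (f := b.coord l) (x := b i) (y := b j) hst
  have hbase {x : Pt} (hx : x ∈ segment ℝ v1 v2) : b.coord 0 x = 0 := by
    obtain ⟨s, t, -, -, hst, hx⟩ := hx
    rw [hcoord (i := 1) (j := 2) hst hx, b.coord_apply, b.coord_apply]
    simp
  have hnonneg {x : Pt} (hx : x ∈ segment ℝ v1 v2) (i : Fin 3) : 0 ≤ b.coord i x := by
    obtain ⟨s, t, hs, ht, hst, hx⟩ := hx
    rw [hcoord (i := 1) (j := 2) hst hx, b.coord_apply, b.coord_apply]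
    exact add_nonneg (mul_nonneg hs (by split_ifs <;> norm_num))
      (mul_nonneg ht (by split_ifs <;> norm_num))
  have hzc : 0 < b.coord 0 z ∧ 0 < b.coord 1 z ∧ b.coord 2 z = 0 := by
    obtain ⟨s, t, hs, ht, hst, hx⟩ := hz
    simp only [hcoord (i := 0) (j := 1) hst hx, b.coord_apply]
    simp [hs, ht]
  have hcomb (x : Pt) : x = b.coord 0 x • v0 + b.coord 1 x • v1 + b.coord 2 x • v2 := by
    conv_lhs => rw [← b.linear_combination_coord_eq_self x, Fin.sum_univ_three]
    rfl
  have hfree (x : Pt) (hx : IsIntPt x) (h0 : 0 < b.coord 0 x) (h1 : 0 < b.coord 1 x) :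
      ¬ 0 < b.coord 2 x := fun h2 => not_coord_pos_of_valid b hvalid hL hx fun i => by
    fin_cases i <;> assumption
  have hleft (x : Pt) (hx : IsIntPt x) (h0 : 0 < b.coord 0 x) (h1 : 0 < b.coord 1 x)
      (h2 : b.coord 2 x = 0) : x = z := by
    refine huniq x ⟨⟨b.coord 0 x, b.coord 1 x, h0, h1, ?_, ?_⟩, hx⟩
    · linarith [coord_add_coord b x]
    · conv_rhs => rw [hcomb x, h2, zero_smul, add_zero]
  have hright (x : Pt) (hx : IsIntPt x) (h0 : 0 < b.coord 0 x) (h2 : 0 < b.coord 2 x) :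
      b.coord 1 x ≠ 0 := by
    intro h1
    refine hopen x ⟨b.coord 0 x, b.coord 2 x, h0, h2, ?_, ?_⟩ hx
    · linarith [coord_add_coord b x]
    · conv_rhs => rw [hcomb x, h1, zero_smul, add_zero]
  obtain ⟨πX, πY, cX, cY, a, d, h, ha, hd, hh, hdh, hah, hX0, hX1, hX2, hY0, hY1, hY2⟩ :=
    exists_normal_form b hfree hv0 h₁ h₂ hne (hbase hs₁) (hbase hs₂) (hnonneg hs₁) (hnonneg hs₂)
      hzi hzc.1 hzc.2.1 hzc.2.2 hleft hright
  obtain ⟨n, hn⟩ := exists_closures_ge_one_of_normal_form b hr_rat hf_rat hα hL hfpos ha hd hh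
    hdh hah hX0 hX1 hX2 hY0 hY1 hY2
  exact ne_top_of_le_ne_top (ENat.natCast_ne_top n) (sInf_le ⟨n, rfl, hn⟩)
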